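/- There exists a constant C > 0 such that w.h.p. the number of cycles of length greater than two in Q^n(1) is at most C·2^n / n^{1.5}. -/

import Mathlib

open scoped Classical
open Filter

noncomputable section

/-- The vertex set of the `n`-dimensional hypercube: `{0,1}^n`. -/
abbrev Vtx (n : ℕ) := Fin n → Bool

/-- The `n`-dimensional hypercube graph `Q^n`: two vertices are adjacent iff they
differ in exactly one coordinate. -/
def cubeGraph (n : ℕ) : SimpleGraph (Vtx n) :=
  SimpleGraph.fromRel (fun u v => hammingDist u v = 1)

/-- Sample space: every vertex independently chooses a uniformly random neighbour. -/
abbrev NbrChoice (n : ℕ) := ∀ v : Vtx n, {u : Vtx n // (cubeGraph n).Adj v u}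

/-- The random graph `Q^n(1)`, with edge set `{{v, f(v)} : v ∈ V}`. -/
def oneOutGraph (n : ℕ) (ω : NbrChoice n) : SimpleGraph (Vtx n) :=
  SimpleGraph.fromRel (fun u v => (ω u : Vtx n) = v)

/-- Uniform (counting) probability of an event on a finite sample space. -/
def prob {Ω : Type*} [Finite Ω] (p : Ω → Prop) : ℝ :=
  (Nat.card {ω : Ω // p ω} : ℝ) / (Nat.card Ω : ℝ)

/-- A (finite) graph is a cycle graph iff it is connected and 2-regular. -/
def IsCycleGraph {V : Type*} (G : SimpleGraph V) : Prop :=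
  G.Connected ∧ ∀ v : V, (G.neighborSet v).ncard = 2

/-- The number of cycles of `G` on at least 4 vertices, i.e. the number of subgraphs
of `G` which are cycle graphs on at least 4 vertices. -/
def longCycleCount {V : Type*} (G : SimpleGraph V) : ℕ :=
  Nat.card {H : G.Subgraph // IsCycleGraph H.coe ∧ 4 ≤ H.verts.ncard}

lemma one_sub_le_prob {Ω : Type*} [Fintype Ω] [Nonempty Ω] (X : Ω → ℝ) (hX : ∀ ω, 0 ≤ X ω)
    {a : ℝ} (ha : 0 < a) :
    1 - (∑ ω, X ω) / (a * Fintype.card Ω) ≤ prob (fun ω => X ω ≤ a) := by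
  have hc : (0 : ℝ) < Fintype.card Ω := by exact_mod_cast Fintype.card_pos
  have h1 : ∑ ω : Ω, (a - if X ω ≤ a then a else 0) ≤ ∑ ω, X ω := by
    refine Finset.sum_le_sum fun ω _ => ?_
    split_ifs with h
    · simpa using hX ω
    · linarith
  rw [Finset.sum_sub_distrib, ← Finset.sum_filter, Finset.sum_const, Finset.sum_const,
    Finset.card_univ, nsmul_eq_mul, nsmul_eq_mul] at h1
  unfold prob
  rw [Nat.card_eq_fintype_card, Nat.card_eq_fintype_card, Fintype.card_subtype,
    sub_le_iff_le_add, ← mul_div_mul_left _ (Fintype.card Ω : ℝ) ha.ne', ← add_div,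
    le_div_iff₀ (by positivity)]
  linarith

lemma prob_le_one {Ω : Type*} [Finite Ω] (p : Ω → Prop) : prob p ≤ 1 := by
  refine div_le_one_of_le₀ ?_ (Nat.cast_nonneg _)
  exact_mod_cast Nat.card_le_card_of_injective _ Subtype.val_injective

/-- The vertex `v` with its `i`-th coordinate flipped. -/
def flipAt {n : ℕ} (v : Vtx n) (i : Fin n) : Vtx n := Function.update v i (!v i)

lemma flipAt_apply {n : ℕ} (v : Vtx n) (i j : Fin n) :
    flipAt v i j = (v j ^^ decide (i = j)) := by
  unfold flipAt
  by_cases h : i = j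
  · subst h; simp
  · simp [Function.update_of_ne (Ne.symm h), h]

lemma cubeGraph_adj_iff {n : ℕ} (v u : Vtx n) :
    (cubeGraph n).Adj v u ↔ ∃ i, flipAt v i = u := by
  have key : (cubeGraph n).Adj v u ↔ hammingDist v u = 1 := by
    rw [cubeGraph, SimpleGraph.fromRel_adj, hammingDist_comm u v, or_self]
    refine ⟨And.right, fun h => ⟨fun h' => ?_, h⟩⟩
    simp [h'] at h
  rw [key, hammingDist, Finset.card_eq_one]
  refine exists_congr fun i => ?_
  constructor
  · intro h
    ext j
    have hj := Finset.ext_iff.1 h j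
    simp only [Finset.mem_filter, Finset.mem_univ, true_and, Finset.mem_singleton] at hj
    rw [flipAt_apply]
    by_cases hij : i = j
    · subst hij
      have := hj.2 rfl
      revert this
      cases v i <;> cases u i <;> simp
    · have : v j = u j := by
        by_contra hne
        exact hij (hj.1 hne).symm
      simp [hij, this]
  · rintro rfl
    ext j
    simp only [Finset.mem_filter, Finset.mem_univ, true_and, Finset.mem_singleton, flipAt_apply]
    by_cases hij : i = j
    · subst hij; simp
    · simp [hij, Ne.symm hij]

lemma flipAt_injective {n : ℕ} (v : Vtx n) : Function.Injective (flipAt v) := by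
  intro i j h
  have := congrFun h i
  simp only [flipAt_apply] at this
  by_contra hij
  revert this
  cases v i <;> simp [Ne.symm hij]

/-- The neighbours of `v` are indexed by the coordinate to be flipped. -/
def nbrEquiv {n : ℕ} (v : Vtx n) : Fin n ≃ {u : Vtx n // (cubeGraph n).Adj v u} :=
  Equiv.ofBijective (fun i => ⟨flipAt v i, (cubeGraph_adj_iff v _).2 ⟨i, rfl⟩⟩)
    ⟨fun _ _ h => flipAt_injective v (congrArg Subtype.val h),
      fun ⟨u, hu⟩ => by
        obtain ⟨i, hi⟩ := (cubeGraph_adj_iff v u).1 hu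
        exact ⟨i, Subtype.ext hi⟩⟩

/-- A neighbour choice amounts to a choice of direction at every vertex. -/
def dirEquiv (n : ℕ) : (Vtx n → Fin n) ≃ NbrChoice n := Equiv.piCongrRight nbrEquiv

/-- The self-map of the cube moving every vertex in its chosen direction. -/
def dirMap {n : ℕ} (d : Vtx n → Fin n) (v : Vtx n) : Vtx n := flipAt v (d v)

/-- Closed words: words of directions in which every direction occurs an even number of times. -/
def closedWords (n l : ℕ) : Finset (Fin l → Fin n) :=
  Finset.univ.filter fun s => ∀ i, Even (Finset.univ.filter fun j => s j = i).card

lemma iterate_dirMap_apply {n : ℕ} (d : Vtx n → Fin n) (v : Vtx n) (i : Fin n) (l : ℕ) :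
    (dirMap d)^[l] v i =
      (v i ^^ decide (Odd (Finset.univ.filter
        fun j : Fin l => d ((dirMap d)^[j] v) = i).card)) := by
  induction l with
  | zero => simp
  | succ l ih =>
    rw [Function.iterate_succ_apply', dirMap, flipAt_apply, ih, Finset.card_filter,
      Finset.card_filter, Fin.sum_univ_castSucc]
    simp only [Fin.val_last, Fin.val_castSucc]
    split_ifs with h
    · simp [h, Nat.odd_add_one, -Nat.not_odd_iff_even]
    · simp [h]

lemma dirWord_mem_closedWords {n : ℕ} (d : Vtx n → Fin n) (v : Vtx n) {l : ℕ}
    (h : (dirMap d)^[l] v = v) : (fun j : Fin l => d ((dirMap d)^[j] v)) ∈ closedWords n l := by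
  simp only [closedWords, Finset.mem_filter, Finset.mem_univ, true_and]
  intro i
  have := iterate_dirMap_apply d v i l
  rw [h] at this
  by_contra hne
  rw [Nat.not_even_iff_odd] at hne
  simp [hne] at this

lemma card_agree_mul_pow {α β : Type*} [Fintype α] [Fintype β] (A : Finset α) (c : α → β) :
    (Finset.univ.filter fun d : α → β => ∀ a ∈ A, d a = c a).card * Fintype.card β ^ A.card =
      Fintype.card β ^ Fintype.card α := by
  have : (Finset.univ.filter fun d : α → β => ∀ a ∈ A, d a = c a) =
      Fintype.piFinset fun a => if a ∈ A then {c a} else Finset.univ := by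
    ext d
    simp only [Finset.mem_filter, Finset.mem_univ, true_and, Fintype.mem_piFinset]
    refine forall_congr' fun a => ?_
    split_ifs with h <;> simp [h]
  rw [this, Fintype.card_piFinset]
  simp only [apply_ite Finset.card, Finset.card_singleton, Finset.card_univ]
  rw [Finset.prod_ite, Finset.prod_const_one, one_mul, Finset.prod_const, ← pow_add]
  congr 1
  rw [← Finset.card_univ, ← Finset.card_filter_add_card_filter_not (s := Finset.univ) (· ∈ A),
    add_comm]
  simp

lemma card_minimalPeriod_mul_le {n : ℕ} (v : Vtx n) (l : ℕ) :
    (Finset.univ.filter fun d : Vtx n → Fin n =>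
        Function.minimalPeriod (dirMap d) v = l).card * n ^ l ≤
      n ^ (2 ^ n) * (closedWords n l).card := by
  by_cases hn : n ^ l = 0
  · simp [hn]
  set P := Finset.univ.filter fun d : Vtx n → Fin n =>
        Function.minimalPeriod (dirMap d) v = l
  have hmaps : ∀ d ∈ P, (fun j : Fin l => d ((dirMap d)^[j] v)) ∈ closedWords n l := by
    intro d hd
    refine dirWord_mem_closedWords d v ?_
    have := Function.iterate_minimalPeriod (f := dirMap d) (x := v)
    rwa [(Finset.mem_filter.1 hd).2] at this
  have := Finset.card_le_mul_card_image_of_maps_to hmaps (n ^ (2 ^ n) / n ^ l) ?_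
  · calc _ ≤ _ := Nat.mul_le_mul_right _ this
      _ = (n ^ (2 ^ n) / n ^ l * n ^ l) * (closedWords n l).card := by ring
      _ ≤ _ := Nat.mul_le_mul_right _ (Nat.div_mul_le_self _ _)
  · intro s _
    rw [Nat.le_div_iff_mul_le (Nat.pos_of_ne_zero hn)]
    rcases (P.filter fun d => (fun j : Fin l => d ((dirMap d)^[j] v)) = s).eq_empty_or_nonempty
      with h0 | ⟨c, hc⟩
    · simp [h0]
    rw [Finset.mem_filter] at hc
    obtain ⟨hcP, hcs⟩ := hc
    have hcl := (Finset.mem_filter.1 hcP).2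
    set A := (Finset.range l).image fun j => (dirMap c)^[j] v with hA
    have hAl : A.card = l := by
      rw [hA, Finset.card_image_of_injOn, Finset.card_range]
      have := Function.iterate_injOn_Iio_minimalPeriod (f := dirMap c) (x := v)
      rw [hcl] at this
      simpa using this
    have hcount := card_agree_mul_pow A c
    rw [hAl] at hcount
    simp only [Fintype.card_fin, Fintype.card_fun, Fintype.card_bool] at hcount
    rw [← hcount]
    refine Nat.mul_le_mul_right _ (Finset.card_le_card fun d hd => ?_)
    rw [Finset.mem_filter] at hd
    obtain ⟨_, hds⟩ := hd
    have hds' : ∀ j < l, d ((dirMap d)^[j] v) = c ((dirMap c)^[j] v) := fun j hj =>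
      congrFun (hds.trans hcs.symm) ⟨j, hj⟩
    have hit : ∀ j ≤ l, (dirMap d)^[j] v = (dirMap c)^[j] v := by
      intro j
      induction j with
      | zero => simp
      | succ j ih =>
        intro hj
        have hh := hds' j hj
        rw [Function.iterate_succ_apply', Function.iterate_succ_apply', dirMap, dirMap, hh,
          ih (by omega)]
    simp only [Finset.mem_filter, Finset.mem_univ, true_and, hA, Finset.mem_image,
      Finset.mem_range]
    rintro _ ⟨j, hj, rfl⟩
    rw [← hds' j hj, hit j hj.le]

/-- The sum of the signs associated with the coordinates of a vertex of the cube. -/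
def signSum {n : ℕ} (x : Vtx n) : ℝ := ∑ i, if x i then 1 else -1

lemma abs_signSum_le {n : ℕ} (x : Vtx n) : |signSum x| ≤ n := by
  refine (Finset.abs_sum_le_sum_abs _ _).trans ?_
  rw [Finset.sum_congr rfl (g := fun _ => (1 : ℝ)) (fun i _ => by split_ifs <;> simp)]
  simp

lemma two_pow_mul_card_closedWords_le (n l : ℕ) :
    2 ^ n * ((closedWords n l).card : ℝ) ≤ ∑ x : Vtx n, signSum x ^ l := by
  have h1 : ∑ x : Vtx n, signSum x ^ l = ∑ s : Fin l → Fin n, ∏ i : Fin n,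
      ∑ b : Bool, (if b then (1 : ℝ) else -1) ^ (Finset.univ.filter fun j => s j = i).card := by
    simp only [signSum, Fintype.sum_pow]
    rw [Finset.sum_comm]
    refine Finset.sum_congr rfl fun s _ => ?_
    rw [Finset.prod_univ_sum, Fintype.piFinset_univ]
    refine Finset.sum_congr rfl fun x _ => ?_
    rw [← Finset.prod_fiberwise_of_maps_to (g := s) (t := Finset.univ)
      (fun _ _ => Finset.mem_univ _)]
    refine Finset.prod_congr rfl fun i _ => ?_
    rw [← Finset.prod_const]
    refine Finset.prod_congr rfl fun j hj => ?_
    rw [(Finset.mem_filter.1 hj).2]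
  rw [h1, mul_comm, ← nsmul_eq_mul, ← Finset.sum_const]
  refine (Finset.sum_le_sum fun s hs => ?_).trans
    (Finset.sum_le_sum_of_subset_of_nonneg (Finset.subset_univ (closedWords n l)) fun s _ _ => ?_)
  · simp only [closedWords, Finset.mem_filter, Finset.mem_univ, true_and] at hs
    rw [Finset.prod_congr rfl (g := fun _ => (2 : ℝ))]
    · simp
    · intro i _
      norm_num [(hs i).neg_one_pow]
  · refine Finset.prod_nonneg fun i _ => ?_
    rcases Nat.even_or_odd (Finset.univ.filter fun j => s j = i).card with h | h <;>
    simp [h.neg_one_pow]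

lemma sum_signSum_succ {n : ℕ} (g : ℝ → ℝ) :
    ∑ x : Vtx (n + 1), g (signSum x) =
      ∑ x : Vtx n, (g (1 + signSum x) + g (-1 + signSum x)) := by
  rw [← (Fin.consEquiv fun _ : Fin (n + 1) => Bool).sum_comp, Fintype.sum_prod_type,
    Fintype.sum_bool, ← Finset.sum_add_distrib]
  refine Finset.sum_congr rfl fun x _ => ?_
  simp [signSum, Fin.sum_univ_succ, Fin.consEquiv]

lemma sum_signSum_pow (n : ℕ) :
    ∑ x : Vtx n, signSum x ^ 2 = 2 ^ n * (n : ℝ) ∧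
    ∑ x : Vtx n, signSum x ^ 4 = 2 ^ n * (3 * (n : ℝ) ^ 2 - 2 * n) ∧
    ∑ x : Vtx n, signSum x ^ 6 = 2 ^ n * (15 * (n : ℝ) ^ 3 - 30 * n ^ 2 + 16 * n) := by
  induction n with
  | zero => simp [signSum]
  | succ n ih =>
    obtain ⟨h2, h4, h6⟩ := ih
    have h0 : ∑ x : Vtx n, (1 : ℝ) = 2 ^ n := by simp
    refine ⟨?_, ?_, ?_⟩
    · rw [sum_signSum_succ (fun t => t ^ 2), Finset.sum_congr rfl
        (g := fun x => 2 * signSum x ^ 2 + 2 * 1) (fun x _ => by ring)]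
      simp only [Finset.sum_add_distrib, ← Finset.mul_sum, h2, h0]
      push_cast; ring
    · rw [sum_signSum_succ (fun t => t ^ 4), Finset.sum_congr rfl
        (g := fun x => 2 * signSum x ^ 4 + 12 * signSum x ^ 2 + 2 * 1) (fun x _ => by ring)]
      simp only [Finset.sum_add_distrib, ← Finset.mul_sum, h2, h4, h0]
      push_cast; ring
    · rw [sum_signSum_succ (fun t => t ^ 6), Finset.sum_congr rfl
        (g := fun x => 2 * signSum x ^ 6 + 30 * signSum x ^ 4 + 30 * signSum x ^ 2 + 2 * 1)
        (fun x _ => by ring)]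
      simp only [Finset.sum_add_distrib, ← Finset.mul_sum, h2, h4, h6, h0]
      push_cast; ring

lemma sum_signSum_pow_mul_le {n k l : ℕ} (hk : Even k) (hkl : k ≤ l) :
    (∑ x : Vtx n, signSum x ^ l) * (n : ℝ) ^ k ≤ n ^ l * ∑ x : Vtx n, signSum x ^ k := by
  rw [Finset.sum_mul, Finset.mul_sum]
  refine Finset.sum_le_sum fun x _ => ?_
  obtain ⟨m, rfl⟩ := Nat.exists_eq_add_of_le hkl
  calc signSum x ^ (k + m) * (n : ℝ) ^ k
      ≤ |signSum x ^ (k + m)| * (n : ℝ) ^ k := by gcongr; exact le_abs_self _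
    _ = |signSum x| ^ m * signSum x ^ k * (n : ℝ) ^ k := by
        rw [abs_pow, pow_add, hk.pow_abs]; ring
    _ ≤ (n : ℝ) ^ m * signSum x ^ k * (n : ℝ) ^ k := by
        have := hk.pow_nonneg (signSum x)
        gcongr
        exact abs_signSum_le x
    _ = _ := by ring

lemma card_closedWords_le_of_four_le {n l : ℕ} (hn : 0 < n) (hl : 4 ≤ l) :
    ((closedWords n l).card : ℝ) ≤ n ^ l * (3 / (n : ℝ) ^ 2) := by
  have hn' : (0 : ℝ) < n := by exact_mod_cast hn
  have h1 := two_pow_mul_card_closedWords_le n l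
  have h2 := sum_signSum_pow_mul_le (n := n) (k := 4) (by decide) hl
  rw [(sum_signSum_pow n).2.1] at h2
  have h3 : (2 : ℝ) ^ n * (3 * (n : ℝ) ^ 2 - 2 * n) ≤ 2 ^ n * (3 * (n : ℝ) ^ 2) := by
    gcongr; linarith
  have h4 : (2 : ℝ) ^ n * n ^ 4 * (closedWords n l).card ≤
      2 ^ n * n ^ 4 * (n ^ l * (3 / (n : ℝ) ^ 2)) :=
    calc (2 : ℝ) ^ n * n ^ 4 * (closedWords n l).card
        = (2 ^ n * (closedWords n l).card) * n ^ 4 := by ring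
      _ ≤ (∑ x : Vtx n, signSum x ^ l) * n ^ 4 := by gcongr
      _ ≤ n ^ l * (2 ^ n * (3 * (n : ℝ) ^ 2)) := h2.trans (by gcongr)
      _ = _ := by field_simp
  exact le_of_mul_le_mul_left h4 (by positivity)

lemma card_closedWords_le_of_six_le {n l : ℕ} (hn : 0 < n) (hl : 6 ≤ l) :
    ((closedWords n l).card : ℝ) ≤ n ^ l * (15 / (n : ℝ) ^ 3) := by
  have hn' : (1 : ℝ) ≤ n := by exact_mod_cast hn
  have h1 := two_pow_mul_card_closedWords_le n l
  have h2 := sum_signSum_pow_mul_le (n := n) (k := 6) (by decide) hl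
  rw [(sum_signSum_pow n).2.2] at h2
  have h3 : (2 : ℝ) ^ n * (15 * (n : ℝ) ^ 3 - 30 * n ^ 2 + 16 * n) ≤ 2 ^ n * (15 * (n : ℝ) ^ 3) := by
    gcongr; nlinarith
  have h4 : (2 : ℝ) ^ n * n ^ 6 * (closedWords n l).card ≤
      2 ^ n * n ^ 6 * (n ^ l * (15 / (n : ℝ) ^ 3)) :=
    calc (2 : ℝ) ^ n * n ^ 6 * (closedWords n l).card
        = (2 ^ n * (closedWords n l).card) * n ^ 6 := by ring
      _ ≤ (∑ x : Vtx n, signSum x ^ l) * n ^ 6 := by gcongr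
      _ ≤ n ^ l * (2 ^ n * (15 * (n : ℝ) ^ 3)) := h2.trans (by gcongr)
      _ = _ := by field_simp
  exact le_of_mul_le_mul_left h4 (by positivity)

section FunctionalGraph

variable {V : Type*} {F : V → V}

/-- The undirected graph underlying the functional digraph of `F`. -/
abbrev functionalGraph (F : V → V) : SimpleGraph V :=
  SimpleGraph.fromRel fun u v => F u = v

lemma IsCycleGraph.adj_map [Finite V]
    {H : (functionalGraph F).Subgraph} (hH : IsCycleGraph H.coe) :
    ∀ v ∈ H.verts, H.Adj v (F v) := by
  have := Fintype.ofFinite V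
  set S : Finset V := H.verts.toFinset with hS
  have memS : ∀ v, v ∈ S ↔ v ∈ H.verts := fun v => by simp [hS]
  set D : Finset (V × V) := Finset.univ.filter fun p => H.Adj p.1 p.2 with hD
  set A : Finset (V × V) := S.image fun v => (v, F v) with hA
  set B : Finset (V × V) := S.image fun v => (F v, v) with hB
  have hAc : A.card = S.card := Finset.card_image_of_injective _ fun a b h => (Prod.ext_iff.1 h).1
  have hBc : B.card = S.card := Finset.card_image_of_injective _ fun a b h => (Prod.ext_iff.1 h).2
  have hDsub : D ⊆ A ∪ B := by
    rintro ⟨u, w⟩ h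
    have hadj : H.Adj u w := by simpa [hD] using h
    have h2 := hadj.adj_sub
    rw [SimpleGraph.fromRel_adj] at h2
    rw [Finset.mem_union]
    rcases h2.2 with h3 | h3
    · left
      exact Finset.mem_image.2 ⟨u, (memS u).2 hadj.fst_mem, by rw [h3]⟩
    · right
      exact Finset.mem_image.2 ⟨w, (memS w).2 hadj.snd_mem, by rw [h3]⟩
  have hDc : D.card = S.card * 2 := by
    rw [Finset.card_eq_sum_card_fiberwise (f := Prod.fst) (t := S), Finset.sum_const_nat]
    · intro u hu
      rw [← hH.2 ⟨u, (memS u).1 hu⟩, ← Set.ncard_coe_finset]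
      symm
      refine Set.ncard_congr (fun w _ => (u, (w : V))) ?_ ?_ ?_
      · intro w hw
        have hadj : H.Adj u w := hw
        simpa [hD] using hadj
      · intro w x _ _ h
        exact Subtype.ext (Prod.ext_iff.1 h).2
      · rintro ⟨u', w⟩ h
        obtain ⟨hadj, rfl⟩ : H.Adj u' w ∧ u' = u := by simpa [hD] using h
        exact ⟨⟨w, hadj.snd_mem⟩, hadj, rfl⟩
    · rintro ⟨u, w⟩ h
      have hadj : H.Adj u w := by simpa [hD] using h
      exact (memS u).2 hadj.fst_mem
  have hun := Finset.card_union_add_card_inter A B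
  have hDeq : D = A ∪ B := Finset.eq_of_subset_of_card_le hDsub (by omega)
  intro v hv
  have : (v, F v) ∈ D := by
    rw [hDeq]
    exact Finset.mem_union_left _ (Finset.mem_image.2 ⟨v, (memS v).2 hv, rfl⟩)
  simpa [hD] using this

lemma IsCycleGraph.verts_eq_and_ncard [Finite V]
    {H : (functionalGraph F).Subgraph} (hH : IsCycleGraph H.coe) {v : V} (hv : v ∈ H.verts) :
    H.verts = Set.range (fun k => F^[k] v) ∧ H.verts.ncard = Function.minimalPeriod F v := by
  have hout := hH.adj_map
  have hmaps : Set.MapsTo F H.verts H.verts := fun u hu => (hout u hu).snd_mem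
  have hsurj : Set.SurjOn F H.verts H.verts := by
    intro u hu
    have h2 := hH.2 ⟨u, hu⟩
    obtain ⟨w, hw, hne⟩ := Set.exists_ne_of_one_lt_ncard
      (by omega : 1 < (H.coe.neighborSet ⟨u, hu⟩).ncard)
      ⟨F u, hmaps hu⟩
    have hadj : H.Adj u w := hw
    have h3 := hadj.adj_sub
    rw [SimpleGraph.fromRel_adj] at h3
    rcases h3.2 with h4 | h4
    · exact absurd (Subtype.ext h4.symm) hne
    · exact ⟨w, w.2, h4⟩
  have hinj : Set.InjOn F H.verts := by
    have hfin : H.verts.Finite := Set.toFinite _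
    exact (hfin.surjOn_iff_bijOn_of_mapsTo hmaps).1 hsurj |>.injOn
  have hper : v ∈ Function.periodicPts F := by
    have hg : Function.Injective (hmaps.restrict F _ _) := hmaps.restrict_inj.2 hinj
    obtain ⟨p, hp, hp'⟩ := hg.mem_periodicPts (⟨v, hv⟩ : H.verts)
    refine ⟨p, hp, ?_⟩
    have h3 := congrArg Subtype.val hp'.eq
    rwa [hmaps.iterate_restrict, Set.MapsTo.val_restrict_apply] at h3
  have hpos := Function.minimalPeriod_pos_of_mem_periodicPts hper
  have hiter : ∀ k, F^[k] v ∈ H.verts := fun k => hmaps.iterate k hv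
  have hverts : H.verts = Set.range (fun k => F^[k] v) := by
    refine Set.Subset.antisymm (fun w hw => ?_) (by rintro _ ⟨k, rfl⟩; exact hiter k)
    have hreach : H.coe.Reachable ⟨v, hv⟩ ⟨w, hw⟩ := hH.1.preconnected _ _
    rw [SimpleGraph.reachable_iff_reflTransGen] at hreach
    suffices ∀ w : H.verts, Relation.ReflTransGen H.coe.Adj ⟨v, hv⟩ w →
        (w : V) ∈ Set.range (fun k => F^[k] v) from this _ hreach
    intro w hw
    induction hw with
    | refl => exact ⟨0, rfl⟩
    | @tail b c _ hbc ih =>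
      obtain ⟨k, hk⟩ := ih
      have hadj : H.Adj b c := hbc
      have h3 := hadj.adj_sub
      rw [SimpleGraph.fromRel_adj] at h3
      simp only at hk
      rcases h3.2 with h4 | h4
      · exact ⟨k + 1, by simp only [Function.iterate_succ_apply', hk, h4]⟩
      · refine ⟨k + Function.minimalPeriod F v - 1, hinj (hiter _) c.2 ?_⟩
        rw [← Function.iterate_succ_apply' F, h4, ← hk,
          show (k + Function.minimalPeriod F v - 1).succ = k + Function.minimalPeriod F v by omega,
          Function.iterate_add_minimalPeriod_eq]
  refine ⟨hverts, ?_⟩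
  have himg : H.verts = ((Finset.range (Function.minimalPeriod F v)).image fun k => F^[k] v :
      Finset V) := by
    rw [hverts]
    ext w
    simp only [Set.mem_range, Finset.coe_image, Finset.coe_range, Set.mem_image, Set.mem_Iio]
    refine ⟨fun ⟨k, hk⟩ => ⟨k % Function.minimalPeriod F v, Nat.mod_lt _ hpos, ?_⟩,
      fun ⟨k, _, hk⟩ => ⟨k, hk⟩⟩
    rw [Function.iterate_mod_minimalPeriod_eq, hk]
  rw [himg, Set.ncard_coe_finset, Finset.card_image_of_injOn, Finset.card_range]
  simpa using Function.iterate_injOn_Iio_minimalPeriod (f := F) (x := v)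

lemma IsCycleGraph.eq_of_mem_verts [Finite V]
    {H K : (functionalGraph F).Subgraph} (hH : IsCycleGraph H.coe) (hK : IsCycleGraph K.coe)
    {v : V} (hvH : v ∈ H.verts) (hvK : v ∈ K.verts) : H = K := by
  have hverts : H.verts = K.verts :=
    (hH.verts_eq_and_ncard hvH).1.trans (hK.verts_eq_and_ncard hvK).1.symm
  have key : ∀ {H K : (functionalGraph F).Subgraph}, IsCycleGraph K.coe → H.verts = K.verts →
      ∀ u w, H.Adj u w → K.Adj u w := by
    intro H K hK hHK u w hadj
    have h3 := hadj.adj_sub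
    rw [SimpleGraph.fromRel_adj] at h3
    rcases h3.2 with h4 | h4
    · exact h4 ▸ hK.adj_map u (hHK ▸ hadj.fst_mem)
    · exact (h4 ▸ hK.adj_map w (hHK ▸ hadj.snd_mem)).symm
  refine SimpleGraph.Subgraph.ext hverts ?_
  ext u w
  exact ⟨key hK hverts u w, key hH hverts.symm u w⟩

lemma longCycleCount_le [Fintype V] (F : V → V) :
    (longCycleCount (SimpleGraph.fromRel fun u v => F u = v) : ℝ) ≤
      ∑ v : V, ∑ l ∈ Finset.Icc 4 (Fintype.card V),
        if Function.minimalPeriod F v = l then (1 / l : ℝ) else 0 := by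
  set T := {H : (functionalGraph F).Subgraph // IsCycleGraph H.coe ∧ 4 ≤ H.verts.ncard}
  have hT : Fintype T := Fintype.ofFinite T
  have h1 : ∀ H : T, (1 : ℝ) = ∑ v : V, if v ∈ H.1.verts then 1 / (H.1.verts.ncard : ℝ) else 0 := by
    intro H
    rw [← Finset.sum_filter, Finset.sum_const, nsmul_eq_mul,
      show (Finset.univ.filter (· ∈ H.1.verts)).card = H.1.verts.ncard by
        rw [← Set.ncard_coe_finset]; simp]
    have : (H.1.verts.ncard : ℝ) ≠ 0 := by
      have := H.2.2
      positivity
    field_simp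
  have h2 : (longCycleCount (SimpleGraph.fromRel fun u v => F u = v) : ℝ) = ∑ H : T, (1 : ℝ) := by
    simp [longCycleCount, T, Nat.card_eq_fintype_card]
  rw [h2, Finset.sum_congr rfl fun H _ => h1 H, Finset.sum_comm]
  refine Finset.sum_le_sum fun v _ => ?_
  have hnn : ∀ l ∈ Finset.Icc 4 (Fintype.card V),
      (0 : ℝ) ≤ if Function.minimalPeriod F v = l then (1 / l : ℝ) else 0 := fun l _ => by
    split_ifs <;> positivity
  by_cases hex : ∃ H : T, v ∈ H.1.verts
  · obtain ⟨H, hvH⟩ := hex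
    rw [Finset.sum_eq_single H]
    · rw [if_pos hvH, (H.2.1.verts_eq_and_ncard hvH).2, Finset.sum_ite_eq, if_pos]
      rw [← (H.2.1.verts_eq_and_ncard hvH).2, Finset.mem_Icc]
      exact ⟨H.2.2, by simpa using Set.ncard_le_card H.1.verts⟩
    · intro K _ hne
      rw [if_neg]
      exact fun hvK => hne (Subtype.ext (K.2.1.eq_of_mem_verts H.2.1 hvK hvH))
    · simp
  · push Not at hex
    rw [Finset.sum_eq_zero fun H _ => if_neg (hex H)]
    exact Finset.sum_nonneg hnn

end FunctionalGraph

lemma sum_Icc_one_div_le (n : ℕ) : ∑ l ∈ Finset.Icc 6 (2 ^ n), 1 / ((l : ℕ) : ℝ) ≤ 1 + n := by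
  have h1 : ∑ l ∈ Finset.Icc 6 (2 ^ n), 1 / ((l : ℕ) : ℝ) ≤
      ∑ l ∈ Finset.Icc 1 (2 ^ n), 1 / ((l : ℕ) : ℝ) :=
    Finset.sum_le_sum_of_subset_of_nonneg (Finset.Icc_subset_Icc_left (by norm_num))
      fun l _ _ => by positivity
  have h2 : ∑ l ∈ Finset.Icc 1 (2 ^ n), 1 / ((l : ℕ) : ℝ) = (harmonic (2 ^ n) : ℚ) := by
    rw [harmonic_eq_sum_Icc]
    push_cast
    simp
  have h3 := harmonic_le_one_add_log (2 ^ n)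
  have h4 : Real.log ((2 ^ n : ℕ) : ℝ) ≤ n := by
    push_cast
    rw [Real.log_pow]
    have := Real.log_two_lt_d9
    nlinarith [(Nat.cast_nonneg n : (0 : ℝ) ≤ n)]
  linarith

lemma sum_closedWords_div_le {n : ℕ} (hn : 3 ≤ n) :
    ∑ l ∈ Finset.Icc 4 (2 ^ n), ((closedWords n l).card / (n : ℝ) ^ l) * (1 / l) ≤
      36 / (n : ℝ) ^ 2 := by
  have hn0 : 0 < n := by omega
  have hn' : (1 : ℝ) ≤ n := by exact_mod_cast hn0
  have h8 : 6 ≤ 2 ^ n := le_trans (by norm_num) (Nat.pow_le_pow_right (n := 2) (by norm_num) hn)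
  have hsplit : Finset.Icc 4 (2 ^ n) = insert 4 (insert 5 (Finset.Icc 6 (2 ^ n))) := by
    ext l
    simp only [Finset.mem_Icc, Finset.mem_insert]
    omega
  have hfour : ∀ l, 4 ≤ l → (closedWords n l).card / (n : ℝ) ^ l ≤ 3 / (n : ℝ) ^ 2 := fun l hl => by
    rw [div_le_iff₀' (by positivity)]
    exact card_closedWords_le_of_four_le hn0 hl
  have hsix : ∀ l, 6 ≤ l → (closedWords n l).card / (n : ℝ) ^ l ≤ 15 / (n : ℝ) ^ 3 := fun l hl => by
    rw [div_le_iff₀' (by positivity)]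
    exact card_closedWords_le_of_six_le hn0 hl
  rw [hsplit, Finset.sum_insert (by simp), Finset.sum_insert (by simp)]
  have h6 : ∑ l ∈ Finset.Icc 6 (2 ^ n), ((closedWords n l).card / (n : ℝ) ^ l) * (1 / l) ≤
      15 / (n : ℝ) ^ 3 * (1 + n) := by
    refine le_trans ?_ (mul_le_mul_of_nonneg_left (sum_Icc_one_div_le n) (by positivity))
    rw [Finset.mul_sum]
    refine Finset.sum_le_sum fun l hl => mul_le_mul_of_nonneg_right (hsix l ?_) (by positivity)
    exact (Finset.mem_Icc.1 hl).1
  have h7 : 15 / (n : ℝ) ^ 3 * (1 + n) ≤ 30 / (n : ℝ) ^ 2 := by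
    rw [div_mul_eq_mul_div, div_le_div_iff₀ (by positivity) (by positivity)]
    nlinarith [pow_pos (by linarith : (0 : ℝ) < n) 2]
  have h4 := hfour 4 (by norm_num)
  have h5 := hfour 5 (by norm_num)
  have h9 : (36 : ℝ) / (n : ℝ) ^ 2 = 3 / (n : ℝ) ^ 2 + 3 / (n : ℝ) ^ 2 + 30 / (n : ℝ) ^ 2 := by ring
  have h10 : (0 : ℝ) ≤ (closedWords n 4).card / (n : ℝ) ^ 4 := by positivity
  have h11 : (0 : ℝ) ≤ (closedWords n 5).card / (n : ℝ) ^ 5 := by positivity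
  push_cast
  linarith

lemma sum_longCycleCount_le {n : ℕ} (hn : 3 ≤ n) :
    ∑ ω : NbrChoice n, (longCycleCount (oneOutGraph n ω) : ℝ) ≤
      Fintype.card (NbrChoice n) * (2 ^ n * (36 / (n : ℝ) ^ 2)) := by
  have hn' : (0 : ℝ) < n := by exact_mod_cast (by omega : 0 < n)
  have hcard : (Fintype.card (NbrChoice n) : ℝ) = n ^ (2 ^ n) := by
    rw [← Fintype.card_congr (dirEquiv n)]
    simp
  have hV : Fintype.card (Vtx n) = 2 ^ n := by simp
  rw [← (dirEquiv n).sum_comp]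
  calc ∑ d : Vtx n → Fin n, (longCycleCount (oneOutGraph n (dirEquiv n d)) : ℝ)
      ≤ ∑ d : Vtx n → Fin n, ∑ v : Vtx n, ∑ l ∈ Finset.Icc 4 (2 ^ n),
        if Function.minimalPeriod (dirMap d) v = l then (1 / l : ℝ) else 0 := by
        refine Finset.sum_le_sum fun d _ => ?_
        have := longCycleCount_le (dirMap d)
        rwa [hV] at this
    _ = ∑ v : Vtx n, ∑ l ∈ Finset.Icc 4 (2 ^ n), ((Finset.univ.filter fun d : Vtx n → Fin n =>
          Function.minimalPeriod (dirMap d) v = l).card : ℝ) * (1 / l) := by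
        rw [Finset.sum_comm]
        refine Finset.sum_congr rfl fun v _ => ?_
        rw [Finset.sum_comm]
        refine Finset.sum_congr rfl fun l _ => ?_
        rw [← Finset.sum_filter, Finset.sum_const, nsmul_eq_mul]
    _ ≤ ∑ v : Vtx n, ∑ l ∈ Finset.Icc 4 (2 ^ n),
          n ^ (2 ^ n) * (((closedWords n l).card / (n : ℝ) ^ l) * (1 / l)) := by
        refine Finset.sum_le_sum fun v _ => Finset.sum_le_sum fun l _ => ?_
        rw [← mul_assoc]
        refine mul_le_mul_of_nonneg_right ?_ (by positivity)
        rw [← mul_div_assoc, le_div_iff₀ (by positivity)]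
        exact_mod_cast card_minimalPeriod_mul_le v l
    _ ≤ _ := by
        simp only [← Finset.mul_sum]
        rw [Finset.sum_const, Finset.card_univ, hV, hcard, nsmul_eq_mul]
        have := sum_closedWords_div_le hn
        push_cast
        gcongr

lemma one_sub_le_prob_longCycleCount {n : ℕ} (hn : 3 ≤ n) :
    1 - 36 / (n : ℝ) ^ (0.5 : ℝ) ≤ prob (fun ω : NbrChoice n =>
      (longCycleCount (oneOutGraph n ω) : ℝ) ≤ 1 * 2 ^ n / (n : ℝ) ^ (1.5 : ℝ)) := by
  have hn' : (0 : ℝ) < n := by exact_mod_cast (by omega : 0 < n)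
  have : Nonempty (NbrChoice n) := ⟨dirEquiv n fun _ => ⟨0, by omega⟩⟩
  have hc : (0 : ℝ) < Fintype.card (NbrChoice n) := by exact_mod_cast Fintype.card_pos
  have ha : (0 : ℝ) < 1 * 2 ^ n / (n : ℝ) ^ (1.5 : ℝ) := by positivity
  refine le_trans ?_ (one_sub_le_prob _ (fun ω => Nat.cast_nonneg _) ha)
  refine sub_le_sub_left ?_ 1
  rw [div_le_iff₀ (by positivity)]
  refine (sum_longCycleCount_le hn).trans (le_of_eq ?_)
  have hpow : (n : ℝ) ^ 2 = (n : ℝ) ^ (0.5 : ℝ) * (n : ℝ) ^ (1.5 : ℝ) := by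
    rw [← Real.rpow_add hn', ← Real.rpow_natCast]
    norm_num
  rw [hpow]
  field_simp

/-- There is a constant `C > 0` such that w.h.p. the number of cycles of length
greater than two in `Q^n(1)` is at most `C·2^n / n^{1.5}`. -/
theorem stmt_11 :
    ∃ C : ℝ, 0 < C ∧
      Tendsto (fun n : ℕ =>
          prob (fun ω : NbrChoice n =>
            (longCycleCount (oneOutGraph n ω) : ℝ) ≤ C * 2 ^ n / (n : ℝ) ^ (1.5 : ℝ)))
        atTop (nhds 1) := by
  refine ⟨1, one_pos, ?_⟩
  have hlim : Tendsto (fun n : ℕ => 1 - 36 / (n : ℝ) ^ (0.5 : ℝ)) atTop (nhds 1) := by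
    have h := ((tendsto_rpow_atTop (by norm_num : (0 : ℝ) < 0.5)).comp
      tendsto_natCast_atTop_atTop).const_div_atTop (36 : ℝ)
    simpa using h.const_sub (1 : ℝ)
  refine tendsto_of_tendsto_of_tendsto_of_le_of_le' hlim tendsto_const_nhds ?_
    (Eventually.of_forall fun n => prob_le_one _)
  filter_upwards [eventually_ge_atTop 3] with n hn
  exact one_sub_le_prob_longCycleCount hn
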